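/- arXiv:1410.1180 — 9 statements merged into one kernel-verified Lean document; each statement's English description precedes it below -/
import Mathlib

section
/- Let d ≥ 2 and let f ∈ ℂ[X] be a monic centered polynomial of degree d². Suppose the derivative f′ has exactly d+1 distinct roots α₁, …, α_{d+1}, each of multiplicity d−1, and suppose f(α₁) = f(α₂) = ⋯ = f(α_d). Then there exist a ∈ ℂ with a ≠ 0 and b ∈ ℂ such that f(z) = (z^d + a)^d + b. -/
open Polynomial

/-- If `f` is a monic centered polynomial of degree `d²` whose derivative has exactly `d+1`
distinct roots `α₀, …, α_d`, each of multiplicity `d-1`, and `f` takes the same value at the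
first `d` of them, then `f(z) = (z^d + a)^d + b` for some `a ≠ 0` and `b`. -/
theorem statement1 (d : ℕ) (hd : 2 ≤ d) (f : Polynomial ℂ)
    (hmonic : f.Monic) (hdeg : f.natDegree = d ^ 2) (hcent : f.coeff (d ^ 2 - 1) = 0)
    (α : Fin (d + 1) → ℂ) (hinj : Function.Injective α)
    (hroots : ∀ z : ℂ, (derivative f).IsRoot z ↔ ∃ i, z = α i)
    (hmult : ∀ i, rootMultiplicity (α i) (derivative f) = d - 1)
    (hval : ∀ i j : Fin (d + 1), (i : ℕ) < d → (j : ℕ) < d → f.eval (α i) = f.eval (α j)) :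
    ∃ a b : ℂ, a ≠ 0 ∧ f = (X ^ d + C a) ^ d + C b := by
  have hd0 : (d : ℂ) ≠ 0 := by
    have : d ≠ 0 := by omega
    exact_mod_cast this
  have hsq : d < d ^ 2 := by nlinarith
  set c := f.eval (α ⟨0, by omega⟩) with hc
  set γ : Fin d → ℂ := fun i => α i.castSucc with hγ
  set β := α (Fin.last d) with hβ
  set g : ℂ[X] := ∏ i, (X - C (γ i)) with hg
  have hγinj : Function.Injective γ := fun i j h => Fin.castSucc_injective d (hinj h)
  have hgm : g.Monic := monic_prod_of_monic _ _ fun i _ => monic_X_sub_C _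
  have hgd : g.natDegree = d := by
    rw [hg, natDegree_prod_of_monic _ _ fun i _ => monic_X_sub_C _]
    simp
  have hgdvd : g ^ d ∣ f - C c := by
    rw [hg, ← Finset.prod_pow]
    apply Finset.prod_dvd_of_coprime
    · intro i _ j _ hij
      exact (pairwise_coprime_X_sub_C hγinj hij).pow
    · intro i _
      by_cases h0 : f - C c = 0
      · rw [h0]; exact dvd_zero _
      have hr : (f - C c).IsRoot (γ i) := by
        have := hval i.castSucc ⟨0, by omega⟩ (by simp) (by simp; omega)
        simp [IsRoot, hc, hγ, this]
      have h1 := derivative_rootMultiplicity_of_root hr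
      have h2 := hmult i.castSucc
      rw [derivative_sub, derivative_C, sub_zero] at h1
      have h3 : d - 1 = (f - C c).rootMultiplicity (γ i) - 1 := by rw [← h1, ← h2]
      exact (pow_dvd_pow _ (by omega)).trans (pow_rootMultiplicity_dvd _ _)
  have hcd : (C c).degree < f.degree := by
    apply degree_lt_degree
    rw [natDegree_C]; omega
  have hfm : (f - C c).Monic := hmonic.sub_of_left hcd
  have hfg : f - C c = g ^ d := by
    apply eq_of_monic_of_dvd_of_natDegree_le (hgm.pow d) hfm hgdvd
    rw [natDegree_sub_C, hdeg, hgm.natDegree_pow, hgd, sq]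
  have hf : f = g ^ d + C c := by rw [← hfg]; ring
  have hcop : IsCoprime (X - C β) g := by
    apply IsCoprime.prod_right
    intro i _
    exact pairwise_coprime_X_sub_C hinj (Fin.castSucc_lt_last i).ne'
  have hdvd : (X - C β) ^ (d - 1) ∣ derivative g := by
    have h1 : (X - C β) ^ (d - 1) ∣ derivative f := by
      have := pow_rootMultiplicity_dvd (derivative f) β
      rwa [hmult] at this
    rw [hf, derivative_add, derivative_C, add_zero, derivative_pow] at h1
    have h2 := (hcop.pow (m := d - 1) (n := d - 1))
    rw [mul_assoc, (isUnit_C.2 (isUnit_iff_ne_zero.2 hd0)).dvd_mul_left] at h1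
    exact h2.dvd_of_dvd_mul_left h1
  have hpm : ((X - C β) ^ d).Monic := (monic_X_sub_C β).pow d
  have hpd : ((X - C β) ^ d).natDegree = d := by simp
  set h := g - (X - C β) ^ d with hh
  have hder : derivative h = 0 := by
    by_cases h0 : h = 0
    · rw [h0]; simp
    have hlt : h.degree < d := by
      have : h.degree < g.degree := by
        apply degree_sub_lt
        · rw [degree_eq_natDegree hgm.ne_zero, degree_eq_natDegree hpm.ne_zero, hgd, hpd]
        · exact hgm.ne_zero
        · rw [hgm.leadingCoeff, hpm.leadingCoeff]
      rwa [degree_eq_natDegree hgm.ne_zero, hgd] at this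
    apply eq_zero_of_dvd_of_degree_lt (p := (X - C β) ^ (d - 1))
    · rw [hh, derivative_sub]
      apply dvd_sub hdvd
      rw [derivative_X_sub_C_pow]
      exact dvd_mul_left _ _
    · rw [degree_pow, degree_X_sub_C, nsmul_one]
      refine (degree_derivative_lt h0).trans_le ?_
      rw [degree_eq_natDegree h0] at hlt ⊢
      have : h.natDegree < d := by exact_mod_cast hlt
      exact_mod_cast (by omega : h.natDegree ≤ d - 1)
  obtain ⟨a, ha⟩ : ∃ a, h = C a := ⟨_, eq_C_of_derivative_eq_zero hder⟩
  have hga : g = (X - C β) ^ d + C a := by rw [← ha, hh]; ring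
  have hβ0 : β = 0 := by
    have h1 : (g ^ d).nextCoeff = 0 := by
      rw [nextCoeff_of_natDegree_pos (by rw [hgm.natDegree_pow, hgd]; nlinarith),
        hgm.natDegree_pow, hgd, ← sq, ← hfg, coeff_sub, hcent, coeff_C_ne_zero (by omega), sub_zero]
    have h2 : g.nextCoeff = ((X - C β) ^ d).nextCoeff := by
      rw [nextCoeff_of_natDegree_pos (by omega), nextCoeff_of_natDegree_pos (by omega), hgd, hpd,
        hga, coeff_add, coeff_C_ne_zero (by omega), add_zero]
    rw [hgm.nextCoeff_pow, h2, (monic_X_sub_C β).nextCoeff_pow, nextCoeff_X_sub_C] at h1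
    simpa [hd0, show d ≠ 0 by omega] using h1
  refine ⟨a, c, ?_, ?_⟩
  · rintro rfl
    have h1 : g.eval (γ ⟨0, by omega⟩) = 0 := by
      rw [hg, eval_prod]
      exact Finset.prod_eq_zero (Finset.mem_univ ⟨0, by omega⟩) (by simp)
    rw [hga, hβ0] at h1
    have h2 : γ ⟨0, by omega⟩ = 0 := by
      simpa [show d ≠ 0 by omega] using h1
    have h3 := hinj (h2.trans hβ0.symm)
    exact (Fin.castSucc_lt_last _).ne h3
  · rw [hf, hga, hβ0]; simp
end

section
/- For a, b ∈ ℂ, the polynomial (z² + a)² + b − z ∈ ℂ[z] has a repeated root (i.e., there exists z₀ ∈ ℂ such that (z − z₀)² divides it) if and only if 256a³ + 288ab + 256a²b² + 256b³ − 27 = 0. -/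
open Polynomial

lemma dvd_of_critical (a b z : ℂ) (h1 : 4 * z ^ 3 + 4 * a * z - 1 = 0)
    (h2 : 4 * a * z ^ 2 - 3 * z + 4 * (a ^ 2 + b) = 0) :
    (X - C z) ^ 2 ∣ ((X ^ 2 + C a) ^ 2 + C b - X) := by
  have hb : b = z - (z ^ 2 + a) ^ 2 := by
    linear_combination (1 / 4) * h2 + (z / 4) * h1
  have h1' : (4 * C z ^ 3 + 4 * C a * C z - 1 : ℂ[X]) = 0 := by
    have := congrArg C h1
    have h4 : (C 4 : ℂ[X]) = 4 := rfl
    simpa [h4] using this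
  refine ⟨X ^ 2 + 2 * C z * X + (2 * C a + 3 * C z ^ 2), ?_⟩
  rw [hb]
  simp only [map_sub, map_add, map_pow]
  linear_combination (X - C z) * h1'

/-- The polynomial `(z² + a)² + b - z` has a repeated root if and only if
`256a³ + 288ab + 256a²b² + 256b³ - 27 = 0`. -/
theorem statement3 (a b : ℂ) :
    (∃ z₀ : ℂ, (X - C z₀) ^ 2 ∣ ((X ^ 2 + C a) ^ 2 + C b - X)) ↔
    256 * a ^ 3 + 288 * a * b + 256 * a ^ 2 * b ^ 2 + 256 * b ^ 3 - 27 = 0 := by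
  constructor
  · rintro ⟨z, q, hq⟩
    have e1 := congrArg (eval z) hq
    have e2 := congrArg (fun p => eval z (derivative p)) hq
    simp [derivative_pow] at e1 e2
    have hb : b = z - (z ^ 2 + a) ^ 2 := by linear_combination e1
    have hw : 4 * z * (z ^ 2 + a) = 1 := by linear_combination e2
    have hz : z ≠ 0 := by
      rintro rfl
      simp at hw
    have ha : a = 1 / (4 * z) - z ^ 2 := by
      field_simp
      linear_combination hw
    have hb' : b = z - (1 / (4 * z)) ^ 2 := by
      rw [hb, ha]; ring
    rw [hb', ha]
    field_simp
    ring
  · intro hD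
    by_cases hd : 9 - 16 * a * b = 0
    · have ha : a ≠ 0 := by
        rintro rfl
        norm_num at hd
      have hb : b = 9 / (16 * a) := by
        field_simp
        linear_combination -hd
      have ht : 64 * a ^ 3 + 27 = 0 := by
        rw [hb] at hD
        field_simp at hD
        have : (64 * a ^ 3 + 27) ^ 2 = 0 := by
          ring_nf at hD ⊢
          linear_combination (1 / 256) * hD
        exact pow_eq_zero_iff (two_ne_zero) |>.1 this
      refine ⟨3 / (8 * a), dvd_of_critical a b _ ?_ ?_⟩
      · field_simp
        linear_combination 4 * ht
      · rw [hb]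
        field_simp
        linear_combination 64 * ht
    · refine ⟨(16 * a ^ 2 + 12 * b) / (9 - 16 * a * b), dvd_of_critical a b _ ?_ ?_⟩
      · have : 4 * (16 * a ^ 2 + 12 * b) ^ 3
            + 4 * a * (16 * a ^ 2 + 12 * b) * (9 - 16 * a * b) ^ 2
            - (9 - 16 * a * b) ^ 3 = 0 := by
          linear_combination (64 * a ^ 3 + 27) * hD
        generalize 9 - 16 * a * b = d at *
        generalize 16 * a ^ 2 + 12 * b = N at *
        field_simp
        linear_combination this
      · have : 4 * a * (16 * a ^ 2 + 12 * b) ^ 2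
            - 3 * (16 * a ^ 2 + 12 * b) * (9 - 16 * a * b)
            + 4 * (a ^ 2 + b) * (9 - 16 * a * b) ^ 2 = 0 := by
          linear_combination (4 * a ^ 2) * hD
        generalize 9 - 16 * a * b = d at *
        generalize 16 * a ^ 2 + 12 * b = N at *
        field_simp
        linear_combination this
end

section
/- Let h₁(a,b) = 256a³ + 288ab + 256a²b² + 256b³ − 27 and let ω = e^{2πi/3} be a primitive third root of unity. Then the set of points (a,b) ∈ ℂ² at which h₁ vanishes together with both of its first-order partial derivatives ∂h₁/∂a = 768a² + 288b + 512ab² and ∂h₁/∂b = 288a + 512a²b + 768b² is exactly the three-point set {(−3/4, −3/4), (−3ω/4, −3ω²/4), (−3ω²/4, −3ω/4)}. -/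
/-- The singular points of the curve `Per₁(1) = {h₁ = 0}` of the biquadratic family, i.e. the
points where `h₁` and both of its first-order partials vanish, are exactly
`(-3/4, -3/4)`, `(-3ω/4, -3ω²/4)`, `(-3ω²/4, -3ω/4)` where `ω = e^{2πi/3}`. -/
theorem statement4 (ω : ℂ) (hω : ω = Complex.exp (2 * Real.pi * Complex.I / 3)) (a b : ℂ) :
    (256 * a ^ 3 + 288 * a * b + 256 * a ^ 2 * b ^ 2 + 256 * b ^ 3 - 27 = 0 ∧
     768 * a ^ 2 + 288 * b + 512 * a * b ^ 2 = 0 ∧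
     288 * a + 512 * a ^ 2 * b + 768 * b ^ 2 = 0) ↔
    ((a, b) = (-(3 / 4), -(3 / 4)) ∨
     (a, b) = (-(3 / 4) * ω, -(3 / 4) * ω ^ 2) ∨
     (a, b) = (-(3 / 4) * ω ^ 2, -(3 / 4) * ω)) := by
  have hprim : IsPrimitiveRoot ω 3 := by
    rw [hω]
    exact_mod_cast Complex.isPrimitiveRoot_exp 3 (by norm_num)
  have h3 : ω ^ 3 = 1 := hprim.pow_eq_one
  have h1 : ω ≠ 1 := hprim.ne_one (by norm_num)
  have hs : 1 + ω + ω ^ 2 = 0 := by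
    apply mul_left_cancel₀ (sub_ne_zero.mpr h1)
    linear_combination h3
  simp only [Prod.mk.injEq]
  constructor
  · rintro ⟨h, ha, hb⟩
    have hp : 16 * (a * b) - 9 = 0 := by
      have : (16 * (a * b) - 9) ^ 2 = 0 := by
        linear_combination (-3) * h + a * ha + b * hb
      exact pow_eq_zero_iff (two_ne_zero) |>.mp this
    have hab : a * b = 9 / 16 := by linear_combination hp / 16
    have ha3 : a ^ 3 = -(27 / 64) := by
      linear_combination a * ha / 768 - (288 + 512 * (a * b + 9 / 16)) / 768 * hab
    have ha0 : a ≠ 0 := by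
      rintro rfl
      norm_num at hab
    have hf : (a + 3 / 4) * ((a + 3 / 4 * ω) * (a + 3 / 4 * ω ^ 2)) = 0 := by
      linear_combination ha3 + (3 / 4 * a ^ 2 + 9 / 16 * a * ω) * hs
        + (27 / 64) * h3
    rcases mul_eq_zero.mp hf with h | h
    · have e : a = -(3 / 4) := by linear_combination h
      refine Or.inl ⟨e, mul_left_cancel₀ ha0 ?_⟩
      rw [hab, e]; norm_num
    rcases mul_eq_zero.mp h with h | h
    · have e : a = -(3 / 4) * ω := by linear_combination h
      refine Or.inr (Or.inl ⟨e, mul_left_cancel₀ ha0 ?_⟩)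
      rw [hab, e]; linear_combination -(9 / 16) * h3
    · have e : a = -(3 / 4) * ω ^ 2 := by linear_combination h
      refine Or.inr (Or.inr ⟨e, mul_left_cancel₀ ha0 ?_⟩)
      rw [hab, e]; linear_combination -(9 / 16) * h3
  · have h4 : ω ^ 4 = ω := by linear_combination ω * h3
    have h5 : ω ^ 5 = ω ^ 2 := by linear_combination ω ^ 2 * h3
    have h6 : ω ^ 6 = 1 := by linear_combination (ω ^ 3 + 1) * h3
    rintro (⟨rfl, rfl⟩ | ⟨rfl, rfl⟩ | ⟨rfl, rfl⟩)
    · norm_num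
    · refine ⟨?_, ?_, ?_⟩ <;> ring_nf <;> simp only [h3, h4, h5, h6] <;> ring
    · refine ⟨?_, ?_, ?_⟩ <;> ring_nf <;> simp only [h3, h4, h5, h6] <;> ring
end

section
/- Fix r ∈ ℂ and a, b ∈ ℂ, and let P_{a,b}(z) = (z² + a)² + b. There exists z ∈ ℂ with P_{a,b}(z) = z and P′_{a,b}(z) = r (i.e., P_{a,b} has a fixed point of multiplier r) if and only if h_r(a,b) = 256a³ + 256ab + 256a²b² + 256b³ + 32ab(2r − r²) + (r⁴ − 12r³ + 48r² − 64r) = 0. -/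
/-- Symmetric form of the backward direction, with `t = r/4 - 1`. -/
lemma exists_pair (t a b : ℂ)
    (h : a ^ 3 + b ^ 3 + a ^ 2 * b ^ 2 - a * b * t * (3 + 2 * t) + (t + 1) * t ^ 3 = 0) :
    ∃ z w : ℂ, z ^ 2 + a = w ∧ w ^ 2 + b = z ∧ z * w = t + 1 := by
  by_cases hD : t ^ 2 - a * b = 0
  · have hab : a * b = t ^ 2 := by linear_combination -hD
    have hsum : a ^ 3 + b ^ 3 = 2 * t ^ 3 := by
      linear_combination h + (-(a * b) - t ^ 2 + t * (3 + 2 * t)) * hab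
    have hsq : (a ^ 3 - t ^ 3) ^ 2 = 0 := by
      linear_combination a ^ 3 * hsum - ((a * b) ^ 2 + a * b * t ^ 2 + t ^ 4) * hab
    have ha : a ^ 3 = t ^ 3 := sub_eq_zero.mp (pow_eq_zero_iff (two_ne_zero) |>.mp hsq)
    have hb : b ^ 3 = t ^ 3 := by linear_combination hsum - ha
    by_cases ht : t = 0
    · subst ht
      have ha0 : a = 0 := by simpa using ha
      have hb0 : b = 0 := by simpa using hb
      subst ha0 hb0
      exact ⟨1, 1, by norm_num, by norm_num, by norm_num⟩
    · obtain ⟨c, rfl⟩ : ∃ c, a = c * t := ⟨a / t, by field_simp⟩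
      have hc : c ^ 3 = 1 := by
        have h3 : t ^ 3 ≠ 0 := pow_ne_zero _ ht
        apply mul_right_cancel₀ h3
        linear_combination ha
      have hcb : c * b = t := by
        apply mul_right_cancel₀ ht
        linear_combination hab
      have hb2 : b = c ^ 2 * t := by linear_combination c ^ 2 * hcb - b * hc
      subst hb2
      obtain ⟨d, hd⟩ := IsAlgClosed.exists_pow_nat_eq (c ^ 2 - 4 * c ^ 2 * (1 + t))
        (n := 2) (by norm_num)
      obtain ⟨w, hw⟩ : ∃ w : ℂ, w ^ 2 + c * w + c ^ 2 * (1 + t) = 0 :=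
        ⟨(d - c) / 2, by linear_combination hd / 4⟩
      refine ⟨-c ^ 2 - c * w, w, ?_, ?_, ?_⟩
      · linear_combination c ^ 2 * hw + (w - c * t) * hc
      · linear_combination hw
      · linear_combination (1 + t) * hc - c * hw
  · refine ⟨(a ^ 2 - b * t) / (t ^ 2 - a * b), (b ^ 2 - a * t) / (t ^ 2 - a * b), ?_, ?_, ?_⟩
    · rw [div_pow, div_add' _ _ _ (pow_ne_zero 2 hD), div_eq_div_iff (pow_ne_zero 2 hD) hD]
      linear_combination (t ^ 2 - a * b) * a * h
    · rw [div_pow, div_add' _ _ _ (pow_ne_zero 2 hD), div_eq_div_iff (pow_ne_zero 2 hD) hD]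
      linear_combination (t ^ 2 - a * b) * b * h
    · rw [div_mul_div_comm, div_eq_iff (mul_ne_zero hD hD)]
      linear_combination -t * h

/-- Symmetric form of the forward direction. -/
lemma forward (t a b z w : ℂ) (h1 : z ^ 2 + a = w) (h2 : w ^ 2 + b = z) (h3 : z * w = t + 1) :
    a ^ 3 + b ^ 3 + a ^ 2 * b ^ 2 - a * b * t * (3 + 2 * t) + (t + 1) * t ^ 3 = 0 := by
  obtain rfl : a = w - z ^ 2 := by linear_combination h1
  obtain rfl : b = z - w ^ 2 := by linear_combination h2
  obtain rfl : t = z * w - 1 := by linear_combination -h3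
  ring

/-- The biquadratic polynomial `P_{a,b}(z) = (z² + a)² + b` has a fixed point of multiplier `r`
if and only if `h_r(a,b) = 0`. -/
theorem statement6 (r a b : ℂ) :
    (∃ z : ℂ, (z ^ 2 + a) ^ 2 + b = z ∧ 4 * z * (z ^ 2 + a) = r) ↔
    256 * a ^ 3 + 256 * a * b + 256 * a ^ 2 * b ^ 2 + 256 * b ^ 3 +
      32 * a * b * (2 * r - r ^ 2) + (r ^ 4 - 12 * r ^ 3 + 48 * r ^ 2 - 64 * r) = 0 := by
  constructor
  · rintro ⟨z, h1, h2⟩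
    have := forward (r / 4 - 1) a b z (z ^ 2 + a) rfl h1 (by linear_combination h2 / 4)
    linear_combination 256 * this
  · intro h
    obtain ⟨z, w, rfl, h2, h3⟩ := exists_pair (r / 4 - 1) a b (by linear_combination h / 256)
    exact ⟨z, h2, by linear_combination 4 * h3⟩
end

section
/- Fix r ∈ ℂ and a, b ∈ ℂ, and let f_{a,b}(z) = z³ − 3az + b. There exists z ∈ ℂ with f_{a,b}(z) = z and f′_{a,b}(z) = r (i.e., f_{a,b} has a fixed point of multiplier r) if and only if h_r(a,b) = 108a³ + 108a² − 27b² − 9a(r − 3)(r + 1) + r(r − 3)² = 0. -/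
/-- The cubic polynomial `f_{a,b}(z) = z³ - 3az + b` has a fixed point of multiplier `r`
if and only if `h_r(a,b) = 108a³ + 108a² - 27b² - 9a(r-3)(r+1) + r(r-3)² = 0`. -/
theorem statement9 (r a b : ℂ) :
    (∃ z : ℂ, z ^ 3 - 3 * a * z + b = z ∧ 3 * z ^ 2 - 3 * a = r) ↔
    108 * a ^ 3 + 108 * a ^ 2 - 27 * b ^ 2 - 9 * a * (r - 3) * (r + 1) + r * (r - 3) ^ 2 = 0 := by
  constructor
  · rintro ⟨z, h1, h2⟩
    have hb : b = z - z ^ 3 + 3 * a * z := by linear_combination h1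
    subst hb
    subst h2
    ring
  · intro h
    obtain ⟨w, hw⟩ := IsAlgClosed.exists_pow_nat_eq (a + r / 3) (n := 2) (by norm_num)
    have hsq : b ^ 2 = (w * (1 + 2 * a - r / 3)) ^ 2 := by
      linear_combination (-1 / 27) * h - (1 + 2 * a - r / 3) ^ 2 * hw
    rcases sq_eq_sq_iff_eq_or_eq_neg.mp hsq with hb | hb
    · refine ⟨w, ?_, ?_⟩
      · linear_combination hb + w * hw
      · linear_combination 3 * hw
    · refine ⟨-w, ?_, ?_⟩
      · linear_combination hb - w * hw
      · linear_combination 3 * hw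
end

section
/- Let g(a,b,c) = −27 − 4a³ + 108b + 8a³b − 162b² − 4a³b² + 108b³ − 27b⁴ + 144ac + 16a⁴c − 288abc + 144ab²c − 128a²c² + 256c³. Then at the point (0,1,0), the function g vanishes, all three first-order partial derivatives ∂g/∂a, ∂g/∂b, ∂g/∂c vanish, and all six second-order partial derivatives ∂²g/∂a², ∂²g/∂b², ∂²g/∂c², ∂²g/∂a∂b, ∂²g/∂a∂c, ∂²g/∂b∂c vanish. In particular, (0,1,0) is a singular point of the hypersurface {g = 0} of multiplicity at least three (a triple point). -/
/-- The derivative of a polynomial function of degree at most four. -/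
theorem deriv_quartic (f : ℂ → ℂ) (p q r s t : ℂ)
    (hf : ∀ x, f x = p + q * x + r * x ^ 2 + s * x ^ 3 + t * x ^ 4) :
    deriv f = fun x => q + 2 * r * x + 3 * s * x ^ 2 + 4 * t * x ^ 3 := by
  funext x
  have e : f = fun x => p + q * x + r * x ^ 2 + s * x ^ 3 + t * x ^ 4 := funext hf
  rw [e]
  have h := (((((hasDerivAt_id x).const_mul q).const_add p).add
    ((hasDerivAt_pow 2 x).const_mul r)).add ((hasDerivAt_pow 3 x).const_mul s)).add
    ((hasDerivAt_pow 4 x).const_mul t)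
  refine HasDerivAt.deriv (h.congr_deriv ?_)
  norm_num
  ring

/-- At the point `(0,1,0)`, the function `g` defining `Per₁(1)` of the quartic family vanishes,
together with all three first-order and all six second-order partial derivatives: `(0,1,0)` is a
singular point of `{g = 0}` of multiplicity at least three (a triple point). -/
theorem statement15 (g : ℂ → ℂ → ℂ → ℂ)
    (hg : ∀ a b c : ℂ, g a b c =
      -27 - 4 * a ^ 3 + 108 * b + 8 * a ^ 3 * b - 162 * b ^ 2 - 4 * a ^ 3 * b ^ 2 +
        108 * b ^ 3 - 27 * b ^ 4 + 144 * a * c + 16 * a ^ 4 * c - 288 * a * b * c +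
        144 * a * b ^ 2 * c - 128 * a ^ 2 * c ^ 2 + 256 * c ^ 3) :
    g 0 1 0 = 0 ∧
    deriv (fun a : ℂ => g a 1 0) 0 = 0 ∧
    deriv (fun b : ℂ => g 0 b 0) 1 = 0 ∧
    deriv (fun c : ℂ => g 0 1 c) 0 = 0 ∧
    deriv (deriv (fun a : ℂ => g a 1 0)) 0 = 0 ∧
    deriv (deriv (fun b : ℂ => g 0 b 0)) 1 = 0 ∧
    deriv (deriv (fun c : ℂ => g 0 1 c)) 0 = 0 ∧
    deriv (fun a : ℂ => deriv (fun b : ℂ => g a b 0) 1) 0 = 0 ∧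
    deriv (fun a : ℂ => deriv (fun c : ℂ => g a 1 c) 0) 0 = 0 ∧
    deriv (fun b : ℂ => deriv (fun c : ℂ => g 0 b c) 0) 1 = 0 := by
  have ha : deriv (fun a : ℂ => g a 1 0) = fun _ => 0 := by
    rw [deriv_quartic _ 0 0 0 0 0 (fun x => by simp only [hg]; ring)]
    funext x; ring
  have hb := deriv_quartic (fun b : ℂ => g 0 b 0) (-27) 108 (-162) 108 (-27)
    (fun x => by simp only [hg]; ring)
  have hc := deriv_quartic (fun c : ℂ => g 0 1 c) 0 0 0 256 0
    (fun x => by simp only [hg]; ring)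
  have hab : ∀ a : ℂ, deriv (fun b : ℂ => g a b 0) 1 = 0 := fun a => by
    rw [deriv_quartic _ (-27 - 4 * a ^ 3) (108 + 8 * a ^ 3) (-162 - 4 * a ^ 3) 108 (-27)
      (fun x => by simp only [hg]; ring)]
    ring
  have hac : ∀ a : ℂ, deriv (fun c : ℂ => g a 1 c) 0 = 16 * a ^ 4 := fun a => by
    rw [deriv_quartic _ 0 (16 * a ^ 4) (-128 * a ^ 2) 256 0
      (fun x => by simp only [hg]; ring)]
    ring
  have hbc : ∀ b : ℂ, deriv (fun c : ℂ => g 0 b c) 0 = 0 := fun b => by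
    rw [deriv_quartic _ (-27 + 108 * b - 162 * b ^ 2 + 108 * b ^ 3 - 27 * b ^ 4) 0 0 256 0
      (fun x => by simp only [hg]; ring)]
    ring
  refine ⟨?_, ?_, ?_, ?_, ?_, ?_, ?_, ?_, ?_, ?_⟩
  · rw [hg]; norm_num
  · rw [ha]
  · rw [hb]; norm_num
  · rw [hc]; norm_num
  · rw [ha]; simp
  · rw [hb, deriv_quartic _ 108 (-324) 324 (-108) 0 (fun x => by ring)]; norm_num
  · rw [hc, deriv_quartic _ 0 0 768 0 0 (fun x => by ring)]; norm_num
  · simp only [hab]; simp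
  · simp only [hac]
    rw [deriv_quartic _ 0 0 0 0 16 (fun x => by ring)]; norm_num
  · simp only [hbc]; simp
end

section
/- Let g(a,b,c) = −27 − 4a³ + 108b + 8a³b − 162b² − 4a³b² + 108b³ − 27b⁴ + 144ac + 16a⁴c − 288abc + 144ab²c − 128a²c² + 256c³. Then the set of points (a,b,c) ∈ ℂ³ at which g and all three first-order partial derivatives ∂g/∂a, ∂g/∂b, ∂g/∂c vanish (the singular locus of Per₁(1)) is exactly the union of the two algebraic sets {(a,b,c) ∈ ℂ³ : b = 1 and a² − 4c = 0} and {(a,b,c) ∈ ℂ³ : 8a³ + 27(1 − b)² = 0 and a² + 12c = 0}. -/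
/-- The singular locus of `Per₁(1)` of the quartic family, i.e. the set of `(a,b,c)` where `g`
and all three of its first-order partial derivatives vanish, is exactly the union of
`{b = 1, a² - 4c = 0}` and `{8a³ + 27(1-b)² = 0, a² + 12c = 0}`. -/
theorem statement17 (g : ℂ → ℂ → ℂ → ℂ)
    (hg : ∀ a b c : ℂ, g a b c =
      -27 - 4 * a ^ 3 + 108 * b + 8 * a ^ 3 * b - 162 * b ^ 2 - 4 * a ^ 3 * b ^ 2 +
        108 * b ^ 3 - 27 * b ^ 4 + 144 * a * c + 16 * a ^ 4 * c - 288 * a * b * c +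
        144 * a * b ^ 2 * c - 128 * a ^ 2 * c ^ 2 + 256 * c ^ 3)
    (a b c : ℂ) :
    (g a b c = 0 ∧
     deriv (fun x : ℂ => g x b c) a = 0 ∧
     deriv (fun y : ℂ => g a y c) b = 0 ∧
     deriv (fun w : ℂ => g a b w) c = 0) ↔
    ((b = 1 ∧ a ^ 2 - 4 * c = 0) ∨
     (8 * a ^ 3 + 27 * (1 - b) ^ 2 = 0 ∧ a ^ 2 + 12 * c = 0)) := by
  have ha : deriv (fun x : ℂ => g x b c) a =
      -12 * a ^ 2 * (b - 1) ^ 2 + 144 * (b - 1) ^ 2 * c + 64 * a ^ 3 * c - 256 * a * c ^ 2 := by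
    have h : (fun x : ℂ => g x b c) = fun x : ℂ =>
        (16 * c) * x ^ 4 + (-4 * (b - 1) ^ 2) * x ^ 3 + (-128 * c ^ 2) * x ^ 2
          + (144 * (b - 1) ^ 2 * c) * x ^ 1 + (-27 * (b - 1) ^ 4 + 256 * c ^ 3) := by
      funext x; rw [hg]; ring
    rw [h]
    have := (((((hasDerivAt_pow 4 a).const_mul (16 * c)).add
      ((hasDerivAt_pow 3 a).const_mul (-4 * (b - 1) ^ 2))).add
      ((hasDerivAt_pow 2 a).const_mul (-128 * c ^ 2))).add
      ((hasDerivAt_pow 1 a).const_mul (144 * (b - 1) ^ 2 * c))).add_const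
      (-27 * (b - 1) ^ 4 + 256 * c ^ 3)
    refine this.deriv.trans ?_
    push_cast
    ring
  have hb : deriv (fun y : ℂ => g a y c) b =
      (b - 1) * (-108 * (b - 1) ^ 2 - 8 * a ^ 3 + 288 * a * c) := by
    have h : (fun y : ℂ => g a y c) = fun y : ℂ =>
        (-27) * y ^ 4 + 108 * y ^ 3 + (-162 - 4 * a ^ 3 + 144 * a * c) * y ^ 2
          + (108 + 8 * a ^ 3 - 288 * a * c) * y ^ 1
          + (-27 - 4 * a ^ 3 + 144 * a * c + 16 * a ^ 4 * c - 128 * a ^ 2 * c ^ 2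
            + 256 * c ^ 3) := by
      funext y; rw [hg]; ring
    rw [h]
    have := (((((hasDerivAt_pow 4 b).const_mul (-27)).add
      ((hasDerivAt_pow 3 b).const_mul 108)).add
      ((hasDerivAt_pow 2 b).const_mul (-162 - 4 * a ^ 3 + 144 * a * c))).add
      ((hasDerivAt_pow 1 b).const_mul (108 + 8 * a ^ 3 - 288 * a * c))).add_const
      (-27 - 4 * a ^ 3 + 144 * a * c + 16 * a ^ 4 * c - 128 * a ^ 2 * c ^ 2 + 256 * c ^ 3)
    refine this.deriv.trans ?_
    push_cast
    ring
  have hc : deriv (fun w : ℂ => g a b w) c =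
      144 * a * (b - 1) ^ 2 + 16 * a ^ 4 - 256 * a ^ 2 * c + 768 * c ^ 2 := by
    have h : (fun w : ℂ => g a b w) = fun w : ℂ =>
        256 * w ^ 3 + (-128 * a ^ 2) * w ^ 2
          + (144 * a * (b - 1) ^ 2 + 16 * a ^ 4) * w ^ 1
          + (-27 * (b - 1) ^ 4 - 4 * a ^ 3 * (b - 1) ^ 2) := by
      funext w; rw [hg]; ring
    rw [h]
    have := ((((hasDerivAt_pow 3 c).const_mul 256).add
      ((hasDerivAt_pow 2 c).const_mul (-128 * a ^ 2))).add
      ((hasDerivAt_pow 1 c).const_mul (144 * a * (b - 1) ^ 2 + 16 * a ^ 4))).add_const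
      (-27 * (b - 1) ^ 4 - 4 * a ^ 3 * (b - 1) ^ 2)
    refine this.deriv.trans ?_
    push_cast
    ring
  rw [ha, hb, hc, hg]
  constructor
  · rintro ⟨h0, h1, h2, h3⟩
    rcases mul_eq_zero.mp h2 with hd | hd
    · left
      have hb1 : b = 1 := sub_eq_zero.mp hd
      subst hb1
      refine ⟨rfl, ?_⟩
      by_contra hne
      have e0 : c * (a ^ 2 - 4 * c) ^ 2 = 0 := by linear_combination h0 / 16
      have e1 : c = 0 := (mul_eq_zero.mp e0).resolve_right (pow_ne_zero 2 hne)
      subst e1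
      have e2 : a ^ 4 = 0 := by linear_combination h3 / 16
      have e3 : a = 0 := pow_eq_zero_iff (by norm_num) |>.mp e2
      subst e3
      exact hne (by ring)
    · right
      have e : (a ^ 2 + 12 * c) ^ 2 = 0 := by
        linear_combination (3 / 16) * h3 + (a / 4) * hd
      have e' : a ^ 2 + 12 * c = 0 := pow_eq_zero_iff (by norm_num) |>.mp e
      exact ⟨by linear_combination (-1 / 4) * hd + 6 * a * e', e'⟩
  · rintro (⟨rfl, h⟩ | ⟨h, h'⟩)
    · obtain rfl : c = a ^ 2 / 4 := by linear_combination (-1 / 4) * h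
      refine ⟨?_, ?_, ?_, ?_⟩ <;> ring
    · obtain rfl : c = -a ^ 2 / 12 := by linear_combination h' / 12
      refine ⟨?_, ?_, ?_, ?_⟩
      · linear_combination (-((b - 1) ^ 2 + 8 * a ^ 3 / 27)) * h
      · linear_combination (-24 * a ^ 2 / 27) * h
      · linear_combination (-4 * (b - 1)) * h
      · linear_combination (144 * a / 27) * h
end

section
/- Let a, b, c ∈ ℂ satisfy 8a³ + 27(1 − b)² = 0 and a² + 12c = 0, with a ≠ 0, and let f(z) = z⁴ + az² + bz + c. Then z₀ = 3(1 − b)/(4a) satisfies f(z₀) = z₀, f′(z₀) = 1, f′′(z₀) = 0 and f′′′(z₀) ≠ 0; that is, f has a parabolic fixed point of multiplier 1 with exactly two petals. -/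
/-- If `8a³ + 27(1-b)² = 0`, `a² + 12c = 0` and `a ≠ 0`, then `z₀ = 3(1-b)/(4a)` is a parabolic
fixed point of `f(z) = z⁴ + az² + bz + c` of multiplier `1` with exactly two petals:
`f(z₀) = z₀`, `f'(z₀) = 1`, `f''(z₀) = 0` and `f'''(z₀) ≠ 0`. -/
theorem statement18 (a b c : ℂ)
    (h1 : 8 * a ^ 3 + 27 * (1 - b) ^ 2 = 0) (h2 : a ^ 2 + 12 * c = 0) (ha : a ≠ 0)
    (f : ℂ → ℂ) (hf : ∀ z : ℂ, f z = z ^ 4 + a * z ^ 2 + b * z + c)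
    (z₀ : ℂ) (hz : z₀ = 3 * (1 - b) / (4 * a)) :
    f z₀ = z₀ ∧
    4 * z₀ ^ 3 + 2 * a * z₀ + b = 1 ∧
    12 * z₀ ^ 2 + 2 * a = 0 ∧
    24 * z₀ ≠ 0 := by
  have h3 : 4 * a * z₀ = 3 * (1 - b) := by
    rw [hz]; field_simp
  have h4 : a = -6 * z₀ ^ 2 := by
    have h5 : a ^ 2 * (a + 6 * z₀ ^ 2) = 0 := by
      linear_combination (1 / 8) * h1 + (3 / 8) * (4 * a * z₀ + 3 * (1 - b)) * h3
    have h6 := (mul_eq_zero.mp h5).resolve_left (pow_ne_zero 2 ha)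
    linear_combination h6
  have hz0 : z₀ ≠ 0 := by
    rintro h
    apply ha
    rw [h4, h]; ring
  have hb : b = 1 + 8 * z₀ ^ 3 := by
    rw [h4] at h3
    linear_combination (1 / 3) * h3
  have hc : c = -3 * z₀ ^ 4 := by
    rw [h4] at h2
    linear_combination (1 / 12) * h2
  refine ⟨?_, ?_, ?_, mul_ne_zero (by norm_num) hz0⟩
  · rw [hf, hb, hc, h4]; ring
  · rw [hb, h4]; ring
  · rw [h4]; ring
end

section
/- Let a, b, c ∈ ℂ and let f(z) = z⁴ + az² + bz + c. Then the greatest common divisor in ℂ[z] of the polynomials f(z) − z and f′(z) − 1 has degree at least 2 if and only if both g(a,b,c) = −27 − 4a³ + 108b + 8a³b − 162b² − 4a³b² + 108b³ − 27b⁴ + 144ac + 16a⁴c − 288abc + 144ab²c − 128a²c² + 256c³ = 0 and 36 + 8a³ − 72b + 36b² − 32ac = 0. -/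
open Polynomial

/-- The algebraic conditions give a common quadratic factor `X ^ 2 + e X + m`. -/
theorem exists_quadratic (a d c : ℂ)
    (h0 : -27 * d ^ 4 - 4 * a ^ 3 * d ^ 2 + 144 * a * d ^ 2 * c + 16 * a ^ 4 * c
      - 128 * a ^ 2 * c ^ 2 + 256 * c ^ 3 = 0)
    (h1 : 9 * d ^ 2 + 2 * a ^ 3 - 8 * a * c = 0) :
    ∃ e m : ℂ, a = 2 * m - 2 * e ^ 2 ∧ d = -4 * e * m ∧ d = e * (a / 2 - m) ∧ c = a / 2 * m := by
  by_cases ha : a = 0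
  · subst ha
    have hd : d = 0 := by
      have : d ^ 2 = 0 := by linear_combination h1 / 9
      exact pow_eq_zero_iff (two_ne_zero) |>.1 this
    subst hd
    have hc : c = 0 := by
      have : c ^ 3 = 0 := by linear_combination h0 / 256
      exact pow_eq_zero_iff (three_ne_zero) |>.1 this
    subst hc
    exact ⟨0, 0, by simp⟩
  · have key : (4 * c - a ^ 2) * (12 * c + a ^ 2) ^ 2 = 0 := by
      linear_combination (9 / 4) * h0 + (27 / 4 * d ^ 2 - 30 * a * c - a ^ 3 / 2) * h1
    have hd : d * (12 * c + a ^ 2) = 0 := by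
      rcases mul_eq_zero.1 key with h | h
      · have : d ^ 2 = 0 := by linear_combination h1 / 9 + 2 * a * h / 9
        rw [pow_eq_zero_iff (two_ne_zero) |>.1 this, zero_mul]
      · rw [pow_eq_zero_iff (two_ne_zero) |>.1 h, mul_zero]
    refine ⟨3 * d / (2 * a), 2 * c / a, ?_, ?_, ?_, ?_⟩
    · field_simp
      linear_combination h1
    · field_simp
      linear_combination hd
    · field_simp
      linear_combination hd
    · field_simp

/-- For `f(z) = z⁴ + az² + bz + c`, the gcd of `f(z) - z` and `f'(z) - 1` has degree at least `2`
if and only if both `g(a,b,c) = 0` and `36 + 8a³ - 72b + 36b² - 32ac = 0`. -/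
theorem statement19 (a b c : ℂ) :
    2 ≤ (EuclideanDomain.gcd (X ^ 4 + C a * X ^ 2 + C b * X + C c - X)
          (C 4 * X ^ 3 + C (2 * a) * X + C b - 1)).natDegree ↔
    (-27 - 4 * a ^ 3 + 108 * b + 8 * a ^ 3 * b - 162 * b ^ 2 - 4 * a ^ 3 * b ^ 2 +
        108 * b ^ 3 - 27 * b ^ 4 + 144 * a * c + 16 * a ^ 4 * c - 288 * a * b * c +
        144 * a * b ^ 2 * c - 128 * a ^ 2 * c ^ 2 + 256 * c ^ 3 = 0 ∧
     36 + 8 * a ^ 3 - 72 * b + 36 * b ^ 2 - 32 * a * c = 0) := by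
  constructor
  · intro h
    set D := EuclideanDomain.gcd (X ^ 4 + C a * X ^ 2 + C b * X + C c - X)
          (C 4 * X ^ 3 + C (2 * a) * X + C b - 1) with hD
    have hP : D ∣ X ^ 4 + C a * X ^ 2 + C b * X + C c - X := EuclideanDomain.gcd_dvd_left _ _
    have hQ : D ∣ C 4 * X ^ 3 + C (2 * a) * X + C b - 1 := EuclideanDomain.gcd_dvd_right _ _
    clear_value D
    obtain ⟨r, hr⟩ := IsAlgClosed.exists_root D
      (by intro h'; have h3 : _ = 0 := natDegree_eq_of_degree_eq_some h'; omega)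
    obtain ⟨E, rfl⟩ := dvd_iff_isRoot.2 hr
    have hE0 : E ≠ 0 := by rintro rfl; simp at h
    rw [natDegree_mul (X_sub_C_ne_zero r) hE0, natDegree_X_sub_C] at h
    obtain ⟨s, hs⟩ := IsAlgClosed.exists_root E
      (by intro h'; have h3 : _ = 0 := natDegree_eq_of_degree_eq_some h'; omega)
    obtain ⟨U, hU⟩ := hP
    obtain ⟨V, hV⟩ := hQ
    have p1 := congrArg (eval r) hU
    have q1 := congrArg (eval r) hV
    simp at p1 q1
    have hU' : X ^ 3 + C r * X ^ 2 + C (r ^ 2 + a) * X + C (r ^ 3 + a * r + b - 1) = E * U := by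
      apply mul_left_cancel₀ (X_sub_C_ne_zero r)
      rw [← mul_assoc, ← hU]
      have : C (r ^ 4 + a * r ^ 2 + b * r + c - r) = 0 := by rw [p1, C_0]
      simp only [map_add, map_sub, map_mul, map_pow, map_one] at this ⊢
      linear_combination -this
    have hV' : C 4 * X ^ 2 + C (4 * r) * X + C (4 * r ^ 2 + 2 * a) = E * V := by
      apply mul_left_cancel₀ (X_sub_C_ne_zero r)
      rw [← mul_assoc, ← hV]
      have : C (4 * r ^ 3 + 2 * a * r + b - 1) = 0 := by rw [q1, C_0]
      simp only [map_add, map_sub, map_mul, map_pow, map_one] at this ⊢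
      linear_combination -this
    have p2 := congrArg (eval s) hU'
    have q2 := congrArg (eval s) hV'
    simp [hs.eq_zero] at p2 q2
    have ha : a = -2 * (r ^ 2 + r * s + s ^ 2) := by linear_combination q2 / 2
    subst ha
    obtain rfl : b = 1 - (s ^ 3 + r * s ^ 2 + r ^ 2 * s + r ^ 3)
        + 2 * (r ^ 2 + r * s + s ^ 2) * (r + s) := by linear_combination p2
    obtain rfl : c = -(r ^ 4 - 2 * (r ^ 2 + r * s + s ^ 2) * r ^ 2
        + (- (s ^ 3 + r * s ^ 2 + r ^ 2 * s + r ^ 3)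
        + 2 * (r ^ 2 + r * s + s ^ 2) * (r + s)) * r) := by linear_combination p1
    have key : (r + s) * (r - s) ^ 2 = 0 := by linear_combination q1
    rcases mul_eq_zero.1 key with h | h
    · obtain rfl : s = -r := by linear_combination h
      constructor <;> ring
    · have h2 := pow_eq_zero_iff (two_ne_zero) |>.1 h
      obtain rfl : s = r := by linear_combination -h2
      constructor <;> ring
  · rintro ⟨h0, h1⟩
    obtain ⟨e, m, ha, hd, hd', hc⟩ := exists_quadratic a (b - 1) c
      (by linear_combination h0) (by linear_combination h1 / 4)
    have hh : a / 2 = m - e ^ 2 := by linear_combination ha / 2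
    rw [hh] at hd' hc
    have hdeg : (X ^ 2 + C e * X + C m).natDegree = 2 := by compute_degree!
    refine hdeg.symm.le.trans ?_
    apply natDegree_le_of_dvd
    · apply EuclideanDomain.dvd_gcd
      · refine ⟨X ^ 2 - C e * X + C (m - e ^ 2), ?_⟩
        obtain rfl : b = 1 + e * (m - e ^ 2 - m) := by linear_combination hd'
        subst ha hc
        simp only [map_add, map_sub, map_mul, map_pow, map_one, map_ofNat]
        ring
      · refine ⟨C 4 * X - C 4 * C e, ?_⟩
        obtain rfl : b = 1 + -4 * e * m := by linear_combination hd
        subst ha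
        simp only [map_add, map_sub, map_mul, map_pow, map_one, map_neg, map_ofNat]
        ring
    · intro h
      have h4 := congrArg (fun p => coeff p 3) (EuclideanDomain.gcd_eq_zero_iff.1 h).2
      simp [coeff_X, coeff_one, coeff_C] at h4
end
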